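/- For every natural number k: the abelian group G_k is ℵ_{k+1}-free, i.e. every subgroup of G_k of cardinality less than ℵ_{k+1} is a free abelian group; and if 2^{ℵ₀} ≥ ℵ_{k+1}, then G_k is not a free abelian group, and moreover G_k is not ℵ_{k+2}-free (it has a non-free subgroup of cardinality ℵ_{k+1}). -/

import Mathlib

/-- The generators of the abelian group `G_k`: `x_{m,η̄,ν}` with `m ≤ k`,
`η̄ : ({0,…,k} ∖ {m}) → 2^ω` and `ν ∈ 2^{<ω}`, and `y_{η̄,n}` with
`η̄ : {0,…,k} → 2^ω` and `n ∈ ℕ`. -/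
inductive Gen (k : ℕ) where
  | x (m : Fin (k + 1)) (η : {ℓ : Fin (k + 1) // ℓ ≠ m} → ℕ → Bool) (ν : List Bool)
  | y (η : Fin (k + 1) → ℕ → Bool) (n : ℕ)

/-- The defining relation of `G_k` for `η̄ ∈ (2^ω)^{k+1}` and `n`, as an element of the
free abelian group on the generators:
`n!·y_{η̄,n+1} - y_{η̄,n} - Σ_{m ≤ k} x_{m, η̄↾({0,…,k}∖{m}), η_m↾n}`. -/
def relGk (k : ℕ) (η : Fin (k + 1) → ℕ → Bool) (n : ℕ) : FreeAbelianGroup (Gen k) :=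
  (n.factorial : ℤ) • FreeAbelianGroup.of (Gen.y η (n + 1))
    - FreeAbelianGroup.of (Gen.y η n)
    - ∑ m : Fin (k + 1),
        FreeAbelianGroup.of (Gen.x m (fun ℓ => η ℓ.1) ((List.range n).map (η m)))

/-- The subgroup of relations defining `G_k`. -/
def relSubgroup (k : ℕ) : AddSubgroup (FreeAbelianGroup (Gen k)) :=
  AddSubgroup.closure {z | ∃ η n, z = relGk k η n}

/-- The abelian group `G_k`, presented by the generators `Gen k` and the relations
`n!·y_{η̄,n+1} = y_{η̄,n} + Σ_{m ≤ k} x_{m, η̄↾({0,…,k}∖{m}), η_m↾n}`. -/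
abbrev Gk (k : ℕ) : Type := FreeAbelianGroup (Gen k) ⧸ relSubgroup k

/-- The image in `G_k` of a generator. -/
def genMk (k : ℕ) (g : Gen k) : Gk k :=
  QuotientAddGroup.mk (FreeAbelianGroup.of g)

/-- The generators all of whose `2^ω`-indices lie in `U`. -/
def genIn (k : ℕ) (U : Set (ℕ → Bool)) : Set (Gen k) :=
  {g | match g with
    | .x _ η _ => ∀ ℓ, η ℓ ∈ U
    | .y η _ => ∀ ℓ, η ℓ ∈ U}

/-- The subgroup `G_U` of `G_k` generated by the generators whose indices all lie
in `U`. -/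
def GU (k : ℕ) (U : Set (ℕ → Bool)) : AddSubgroup (Gk k) :=
  AddSubgroup.closure (genMk k '' genIn k U)

/-- The subgroup `G_{U,u}` of `G_k` generated by the union of the subgroups
`G_{U ∪ (u ∖ {η})}` for `η ∈ u`. -/
def GUu (k : ℕ) (U u : Set (ℕ → Bool)) : AddSubgroup (Gk k) :=
  ⨆ η ∈ u, GU k (U ∪ (u \ {η}))

section Algebra

theorem Finsupp.exists_mem_dvd_of_isPrincipalIdealRing {R : Type*} [CommRing R]
    [IsPrincipalIdealRing R] {ι : Type*} [LinearOrder ι]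
    (N : Submodule R (ι →₀ R)) (i : ι) :
    ∃ v ∈ N, (∀ j, i < j → v j = 0) ∧
      ∀ w ∈ N, (∀ j, i < j → w j = 0) → v i ∣ w i := by
  let N' : Submodule R (ι →₀ R) := N ⊓ ⨅ j : Set.Ioi i, LinearMap.ker (Finsupp.lapply j.1)
  have hN' : ∀ w, w ∈ N' ↔ w ∈ N ∧ ∀ j, i < j → w j = 0 := by
    intro w
    simp [N', Submodule.mem_iInf]
  let J : Ideal R := N'.map (Finsupp.lapply i)
  obtain ⟨v, hv, hvi⟩ := Submodule.mem_map.1 (Submodule.IsPrincipal.generator_mem J)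
  refine ⟨v, ((hN' v).1 hv).1, ((hN' v).1 hv).2, fun w hw hw' => ?_⟩
  have hmem : w i ∈ J := Submodule.mem_map.2 ⟨w, (hN' w).2 ⟨hw, hw'⟩, rfl⟩
  rw [Submodule.IsPrincipal.mem_iff_generator_dvd J, ← hvi] at hmem
  exact hmem

variable {R : Type*} [CommRing R] [IsDomain R] [IsPrincipalIdealRing R]

theorem Finsupp.free_submodule_of_isPrincipalIdealRing {ι : Type*} (N : Submodule R (ι →₀ R)) :
    Module.Free R N := by
  classical
  obtain ⟨_, _, -⟩ := Cardinal.exists_ord_eq_type_lt ι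
  choose v hvN hv hdvd using Finsupp.exists_mem_dvd_of_isPrincipalIdealRing N
  let b : {i // v i i ≠ 0} → N := fun i => ⟨v i, hvN i⟩
  have hli : LinearIndependent R b := by
    refine LinearIndependent.of_comp N.subtype ?_
    rw [linearIndependent_iff]
    intro c hc
    by_contra hne
    obtain ⟨i, hi, himax⟩ := c.support.exists_max_image (fun i => i.1)
      (Finsupp.support_nonempty_iff.2 hne)
    have h := DFunLike.congr_fun hc i.1
    simp only [Finsupp.linearCombination_apply, Finsupp.sum, Finsupp.finsetSum_apply,
      Finsupp.smul_apply, b, Function.comp_apply, Submodule.subtype_apply,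
      Finsupp.zero_apply] at h
    rw [Finset.sum_eq_single_of_mem i hi] at h
    · exact (mul_ne_zero (Finsupp.mem_support_iff.1 hi) i.2) h
    · intro j hj hji
      rw [hv j.1 i.1 (lt_of_le_of_ne (himax j hj) fun h => hji (Subtype.ext h)), smul_zero]
  have hspan : ∀ i, ∀ w : N, (∀ j, i < j → w.1 j = 0) → w ∈ Submodule.span R (Set.range b) := by
    intro i
    induction i using WellFoundedLT.induction with
    | ind i ih =>
      intro w hw
      have key : ∀ w : N, (∀ j, i ≤ j → w.1 j = 0) → w ∈ Submodule.span R (Set.range b) := by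
        intro w hw
        by_cases h0 : w.1 = 0
        · rw [show w = 0 from Subtype.ext h0]
          exact Submodule.zero_mem _
        obtain ⟨j, hj, hjmax⟩ := w.1.support.exists_max_image id
          (Finsupp.support_nonempty_iff.2 h0)
        refine ih j (lt_of_not_ge fun h => Finsupp.mem_support_iff.1 hj (hw j h)) w ?_
        intro l hl
        by_contra hne
        exact absurd (hjmax l (Finsupp.mem_support_iff.2 hne)) (not_le.2 hl)
      obtain ⟨c, hc⟩ := hdvd i w.1 w.2 hw
      by_cases hvi : v i i = 0
      · refine key w fun j hj => ?_
        rcases hj.eq_or_lt with rfl | hj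
        · rw [hc, hvi, zero_mul]
        · exact hw j hj
      · have hb : b ⟨i, hvi⟩ ∈ Submodule.span R (Set.range b) :=
          Submodule.subset_span ⟨_, rfl⟩
        rw [← sub_add_cancel w (c • b ⟨i, hvi⟩)]
        refine Submodule.add_mem _ (key _ fun j hj => ?_) (Submodule.smul_mem _ _ hb)
        rcases hj.eq_or_lt with rfl | hj
        · simp [b, hc, mul_comm]
        · simp [b, hw j hj, hv i j hj]
  refine Module.Free.of_basis (Module.Basis.mk hli fun w _ => ?_)
  by_cases h0 : w.1 = 0
  · rw [show w = 0 from Subtype.ext h0]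
    exact Submodule.zero_mem _
  obtain ⟨j, hj, hjmax⟩ := w.1.support.exists_max_image id (Finsupp.support_nonempty_iff.2 h0)
  refine hspan j w fun l hl => ?_
  by_contra hne
  exact absurd (hjmax l (Finsupp.mem_support_iff.2 hne)) (not_le.2 hl)

/-- A submodule of a free module over a principal ideal domain is free. -/
theorem Submodule.free_of_isPrincipalIdealRing {M : Type*} [AddCommGroup M] [Module R M]
    [Module.Free R M] (N : Submodule R M) : Module.Free R N := by
  let e := Module.Free.chooseBasis R M |>.repr
  have := Finsupp.free_submodule_of_isPrincipalIdealRing (N.map e.toLinearMap)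
  exact Module.Free.of_equiv (e.submoduleMap N).symm

theorem Submodule.free_of_injOn {M M' : Type*} [AddCommGroup M] [Module R M] [AddCommGroup M']
    [Module R M'] [Module.Free R M] (f : M →ₗ[R] M') (K : Submodule R M)
    (hf : ∀ v ∈ K, f v = 0 → v = 0) (H : Submodule R M') (hH : H ≤ K.map f) :
    Module.Free R H := by
  have := Submodule.free_of_isPrincipalIdealRing (K ⊓ H.comap f)
  let g : ↥(K ⊓ H.comap f) →ₗ[R] H := f.restrict fun v hv => hv.2
  refine Module.Free.of_equiv (LinearEquiv.ofBijective g ⟨?_, ?_⟩)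
  · rw [injective_iff_map_eq_zero]
    intro v hv
    exact Subtype.ext (hf v.1 v.2.1 (congrArg Subtype.val hv))
  · rintro ⟨h, hh⟩
    obtain ⟨v, hv, rfl⟩ := hH hh
    exact ⟨⟨v, hv, hh⟩, rfl⟩

/-- If each relator `r i` has a generator `d i` with coefficient `-1`, and `d j` occurs in a
different relator `r i` only when `j` has smaller rank than `i`, then the presented group is
free: the generators outside the range of `d` form a basis. -/
theorem free_quotient_span_of_triangular {S I W : Type*} [LinearOrder W] [WellFoundedLT W]
    (r : I → S →₀ ℤ) (d : I → S) (hd : ∀ i, r i (d i) = -1) (rank : I → W)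
    (hrank : ∀ i j, j ≠ i → r i (d j) ≠ 0 → rank j < rank i) :
    Module.Free ℤ ((S →₀ ℤ) ⧸ Submodule.span ℤ (Set.range r)) := by
  classical
  set N := Submodule.span ℤ (Set.range r)
  let b : {s // s ∉ Set.range d} → (S →₀ ℤ) ⧸ N := fun s => N.mkQ (Finsupp.single s.1 1)
  have hli : LinearIndependent ℤ b := by
    rw [linearIndependent_iff]
    intro c hc
    have hcN : Finsupp.mapDomain Subtype.val c ∈ N := by
      rw [← Submodule.ker_mkQ N, LinearMap.mem_ker, ← hc, Finsupp.mapDomain,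
        Finsupp.linearCombination_apply, Finsupp.sum, Finsupp.sum, map_sum]
      refine Finset.sum_congr rfl fun s _ => ?_
      rw [← map_smul, Finsupp.smul_single, smul_eq_mul, mul_one]
    obtain ⟨e, he⟩ := (Finsupp.mem_span_range_iff_exists_finsupp).1 hcN
    have he0 : e = 0 := by
      by_contra hne
      obtain ⟨i, hi, himax⟩ := e.support.exists_max_image rank
        (Finsupp.support_nonempty_iff.2 hne)
      have h := DFunLike.congr_fun he (d i)
      rw [Finsupp.mapDomain_of_notMem_range _ _ (by rintro ⟨⟨s, hs⟩, rfl⟩; exact hs ⟨i, rfl⟩),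
        Finsupp.sum, Finsupp.finsetSum_apply, Finset.sum_eq_single_of_mem i hi] at h
      · rw [Finsupp.smul_apply, hd i] at h
        exact Finsupp.mem_support_iff.1 hi (by simpa using h)
      · intro j hj hji
        rw [Finsupp.smul_apply]
        by_cases h0 : r j (d i) = 0
        · rw [h0, smul_zero]
        · exact absurd (hrank j i hji.symm h0) (not_lt.2 (himax j hj))
    rw [he0, Finsupp.sum_zero_index] at he
    exact Finsupp.mapDomain_injective Subtype.val_injective (by rw [← he, Finsupp.mapDomain_zero])
  have hgen : ∀ i, N.mkQ (Finsupp.single (d i) 1) ∈ Submodule.span ℤ (Set.range b) := by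
    intro i
    induction hw : rank i using WellFoundedLT.induction generalizing i with
    | ind w ih =>
      have h0 : N.mkQ (r i) = 0 := by
        rw [← LinearMap.mem_ker, Submodule.ker_mkQ]
        exact Submodule.subset_span ⟨i, rfl⟩
      have hsum : r i = Finsupp.single (d i) (-1) + (r i).erase (d i) := by
        rw [← hd i, Finsupp.single_add_erase]
      have hd' : N.mkQ (Finsupp.single (d i) 1) = N.mkQ ((r i).erase (d i)) := by
        rw [hsum, map_add, Finsupp.single_neg, map_neg, neg_add_eq_zero] at h0
        exact h0
      rw [hd', ← Finsupp.sum_single ((r i).erase (d i)), Finsupp.sum, map_sum]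
      refine Submodule.sum_mem _ fun s hs => ?_
      rw [← mul_one (((r i).erase (d i)) s), ← smul_eq_mul, ← Finsupp.smul_single, map_smul]
      refine Submodule.smul_mem _ _ ?_
      rw [Finsupp.support_erase, Finset.mem_erase] at hs
      by_cases hsd : s ∈ Set.range d
      · obtain ⟨j, rfl⟩ := hsd
        refine ih (rank j) ?_ j rfl
        rw [← hw]
        exact hrank i j (fun h => hs.1 (by rw [h])) (Finsupp.mem_support_iff.1 hs.2)
      · exact Submodule.subset_span ⟨⟨s, hsd⟩, rfl⟩
  refine Module.Free.of_basis (Module.Basis.mk hli fun w _ => ?_)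
  obtain ⟨v, rfl⟩ := N.mkQ_surjective w
  rw [← Finsupp.sum_single v, Finsupp.sum, map_sum]
  refine Submodule.sum_mem _ fun s _ => ?_
  rw [← mul_one (v s), ← smul_eq_mul, ← Finsupp.smul_single, map_smul]
  refine Submodule.smul_mem _ _ ?_
  by_cases hsd : s ∈ Set.range d
  · obtain ⟨j, rfl⟩ := hsd
    exact hgen j
  · exact Submodule.subset_span ⟨⟨s, hsd⟩, rfl⟩

end Algebra

section Combinatorics

open Cardinal

theorem exists_ordinal_lt_iff {T : Type} {W : Type*} [LinearOrder W] [WellFoundedLT W]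
    (key : T → W) (A : Set T) (hkey : Set.InjOn key A) :
    ∃ f : T → Ordinal.{0}, ∀ a ∈ A, ∀ b ∈ A, f a < f b ↔ key a < key b := by
  classical
  let g : A ↪ W := ⟨fun a => key a, fun a b h => Subtype.ext (hkey a.2 b.2 h)⟩
  let r : A → A → Prop := Order.Preimage g (· < ·)
  have : IsWellOrder A r := (RelEmbedding.preimage g (· < ·)).isWellOrder
  refine ⟨fun a => if h : a ∈ A then Ordinal.typein r ⟨a, h⟩ else 0, fun a ha b hb => ?_⟩
  simp only [dif_pos ha, dif_pos hb, Ordinal.typein_lt_typein]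
  rfl

theorem exists_ordinal_rank_of_le_aleph_succ {α : Type} (k : ℕ) (s : Set α)
    (hs : #s ≤ ℵ_ (k + 1)) :
    ∃ ρ : α → Ordinal.{0}, Set.InjOn ρ s ∧ ∀ M ∈ s, #{x | x ∈ s ∧ ρ x ≤ ρ M} ≤ ℵ_ k := by
  classical
  obtain ⟨_, _, hord⟩ := Cardinal.exists_ord_eq_type_lt s
  let ρ : α → Ordinal.{0} := fun x =>
    if h : x ∈ s then Ordinal.typein (α := s) (· < ·) ⟨x, h⟩ else 0
  have hlt : ∀ a b : s, ρ a < ρ b ↔ a < b := by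
    intro a b
    simp only [ρ, dif_pos a.2, dif_pos b.2]
    exact Ordinal.typein_lt_typein _
  have hinj : Set.InjOn ρ s := by
    intro a ha b hb h
    have h1 := (hlt ⟨a, ha⟩ ⟨b, hb⟩).not.1 (by simp [h])
    have h2 := (hlt ⟨b, hb⟩ ⟨a, ha⟩).not.1 (by simp [h])
    exact congrArg Subtype.val (le_antisymm (not_lt.1 h2) (not_lt.1 h1))
  refine ⟨ρ, hinj, fun M hM => ?_⟩
  have hsub : {x | x ∈ s ∧ ρ x ≤ ρ M} ⊆
      insert M (Subtype.val '' Set.Iio (⟨M, hM⟩ : s)) := by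
    rintro x ⟨hx, hxM⟩
    rcases hxM.eq_or_lt with h | h
    · exact Or.inl (hinj hx hM h)
    · exact Or.inr ⟨⟨x, hx⟩, (hlt ⟨x, hx⟩ ⟨M, hM⟩).1 h, rfl⟩
  have hIio : #(Set.Iio (⟨M, hM⟩ : s)) ≤ ℵ_ k := by
    have := (Cardinal.mk_Iio_lt (⟨M, hM⟩ : s) hord).trans_le hs
    rwa [← Cardinal.succ_aleph, Order.lt_succ_iff] at this
  calc #{x | x ∈ s ∧ ρ x ≤ ρ M}
      ≤ _ := Cardinal.mk_le_mk_of_subset hsub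
    _ ≤ _ := Cardinal.mk_insert_le
    _ ≤ ℵ_ k + 1 := by gcongr; exact Cardinal.mk_image_le.trans hIio
    _ = ℵ_ k := Cardinal.add_one_eq (Cardinal.aleph0_le_aleph _)

theorem exists_first_argmax {n : ℕ} {W : Type*} [LinearOrder W] (a : Fin (n + 1) → W) :
    ∃ p, (∀ q, a q ≤ a p) ∧ ∀ q < p, a q < a p := by
  obtain ⟨p, -, hp⟩ := Finset.univ.exists_max_image (fun q => toLex (a q, OrderDual.toDual q))
    ⟨0, Finset.mem_univ _⟩
  have h : ∀ q, a q < a p ∨ a q = a p ∧ p ≤ q := fun q => by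
    simpa [Prod.Lex.toLex_le_toLex] using hp q (Finset.mem_univ q)
  refine ⟨p, fun q => ?_, fun q hq => ?_⟩
  · rcases h q with h | h
    exacts [h.le, h.1.le]
  · rcases h q with h | h
    exacts [h, absurd h.2 (not_le.2 hq)]

/-- If `s` has at most `ℵ_k` elements, then the `(k+1)`-tuples from `s` can be well-ordered so
that through every tuple passes a line in a coordinate direction containing only finitely many
smaller tuples. -/
theorem exists_ordinal_rank_finite_line {α : Type} (k : ℕ) (s : Set α) (hs : #s ≤ ℵ_ k) :
    ∃ (f : (Fin (k + 1) → α) → Ordinal.{0}) (ℓ : (Fin (k + 1) → α) → Fin (k + 1)),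
      Set.InjOn f {a | ∀ j, a j ∈ s} ∧ ∀ a, (∀ j, a j ∈ s) →
        {b | (∀ j, b j ∈ s) ∧ f b < f a ∧ ∀ j, j ≠ ℓ a → b j = a j}.Finite := by
  classical
  induction k generalizing s with
  | zero =>
    have hc : s.Countable := by simpa using hs
    obtain ⟨g, hg⟩ := Set.countable_iff_exists_injOn.1 hc
    have hinj : Set.InjOn (fun a : Fin 1 → α => g (a 0)) {a | ∀ j, a j ∈ s} := by
      intro a ha b hb h
      ext j
      rw [Subsingleton.elim j 0]
      exact hg (ha 0) (hb 0) h
    refine ⟨fun a => (g (a 0) : Ordinal), fun _ => 0, ?_, fun a _ => ?_⟩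
    · intro a ha b hb h
      exact hinj ha hb (by simpa using h)
    · refine Set.Finite.of_finite_image (f := fun a : Fin 1 → α => g (a 0))
        ((Set.finite_Iio (g (a 0))).subset ?_) (hinj.mono fun b hb => hb.1)
      rintro _ ⟨b, hb, rfl⟩
      simpa using hb.2.1
  | succ k ih =>
    obtain ⟨ρ, hρ, hcard⟩ := exists_ordinal_rank_of_le_aleph_succ k s (by exact_mod_cast hs)
    have ih' : ∀ M, ∃ (f : (Fin (k + 1) → α) → Ordinal.{0})
        (ℓ : (Fin (k + 1) → α) → Fin (k + 1)), M ∈ s →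
        Set.InjOn f {a | ∀ j, a j ∈ s ∧ ρ (a j) ≤ ρ M} ∧
        ∀ a, (∀ j, a j ∈ s ∧ ρ (a j) ≤ ρ M) →
        {b | (∀ j, b j ∈ s ∧ ρ (b j) ≤ ρ M) ∧ f b < f a ∧ ∀ j, j ≠ ℓ a → b j = a j}.Finite := by
      intro M
      by_cases hM : M ∈ s
      · obtain ⟨f, ℓ, h⟩ := ih _ (hcard M hM)
        exact ⟨f, ℓ, fun _ => h⟩
      · exact ⟨fun _ => 0, fun _ => 0, fun h => absurd h hM⟩
    choose g m hgm using ih'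
    choose p hpmax hpfirst using fun a : Fin (k + 2) → α => exists_first_argmax (fun j => ρ (a j))
    let key : (Fin (k + 2) → α) → Ordinal.{0} ×ₗ (Fin (k + 2) ×ₗ Ordinal.{0}) := fun a =>
      toLex (ρ (a (p a)), toLex (p a, g (a (p a)) ((p a).removeNth a)))
    have hrest : ∀ a : Fin (k + 2) → α, (∀ j, a j ∈ s) →
        ∀ j, (p a).removeNth a j ∈ s ∧ ρ ((p a).removeNth a j) ≤ ρ (a (p a)) :=
      fun a ha j => ⟨ha _, hpmax a _⟩
    have hkey : Set.InjOn key {a | ∀ j, a j ∈ s} := by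
      intro a ha b hb h
      simp only [key, EmbeddingLike.apply_eq_iff_eq, Prod.mk.injEq] at h
      obtain ⟨h1, h2, h3⟩ := h
      have h1' := hρ (ha _) (hb _) h1
      have hb' := hrest b hb
      rw [← h1'] at h3 hb'
      have h4 := (hgm _ (ha _)).1 (hrest a ha) hb' h3
      rw [← Fin.insertNth_self_removeNth (p a) a, ← Fin.insertNth_self_removeNth (p b) b, h4, h1',
        h2]
    obtain ⟨f, hf⟩ := exists_ordinal_lt_iff key _ hkey
    refine ⟨f, fun a => (p a).succAbove (m (a (p a)) ((p a).removeNth a)), ?_, fun a ha => ?_⟩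
    · intro a ha b hb h
      refine hkey ha hb (le_antisymm ?_ ?_)
      · exact not_lt.1 ((hf b hb a ha).not.1 (by simp [h]))
      · exact not_lt.1 ((hf a ha b hb).not.1 (by simp [h]))
    · set l := (p a).succAbove (m (a (p a)) ((p a).removeNth a)) with hl
      refine ((Set.finite_singleton (Function.update a l (a (p a)))).union
        (((hgm _ (ha (p a))).2 _ (hrest a ha)).image
          ((p a).insertNth (α := fun _ => α) (a (p a))))).subset ?_
      rintro b ⟨hb, hlt, hline⟩
      have hpa : b (p a) = a (p a) := hline _ (Fin.succAbove_ne _ _).symm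
      rw [hf b hb a ha] at hlt
      simp only [key, Prod.Lex.toLex_lt_toLex] at hlt
      have hge : ρ (a (p a)) ≤ ρ (b (p b)) := hpa ▸ hpmax b (p a)
      obtain ⟨heq, hlt⟩ := hlt.resolve_left (not_lt.2 hge)
      have hM : b (p b) = a (p a) := hρ (hb _) (ha _) heq
      rcases hlt with hlt | ⟨hp, hlt⟩
      · left
        have hpl : p b = l := by
          by_contra hne
          have := hpfirst a _ hlt
          rw [← hline _ hne, hM] at this
          exact lt_irrefl _ this
        ext j
        by_cases hj : j = l
        · rw [hj, Function.update_self, ← hM, hpl]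
        · rw [Function.update_of_ne hj, hline j hj]
      · right
        have hb' := hrest b hb
        rw [hM] at hlt hb'
        rw [hp] at hlt hb'
        refine ⟨(p a).removeNth b, ⟨hb', hlt, fun j hj => ?_⟩, ?_⟩
        · exact hline _ fun h => hj (Fin.succAbove_right_injective h)
        · rw [← hpa, Fin.insertNth_self_removeNth]

/-- A free set theorem of Kuratowski: if `c` assigns a countable set to each finite set and `s`
has at least `ℵ_{k+1}` elements, then some `k+1` elements of `s` are such that none lies in the
set assigned to the others. -/
theorem exists_free_tuple {α : Type} (k : ℕ) (c : Set α → Set α)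
    (hc : ∀ v, v.Finite → (c v).Countable) (s : Set α) (hs : ℵ_ (k + 1) ≤ #s) :
    ∃ a : Fin (k + 1) → α, (∀ j, a j ∈ s) ∧ ∀ j, a j ∉ c (a '' {j}ᶜ) := by
  classical
  induction k generalizing c s with
  | zero =>
    have h1 : ¬ s ⊆ c ∅ := by
      intro hsub
      have h1 := hs.trans ((Cardinal.mk_le_mk_of_subset hsub).trans
        (Cardinal.mk_le_aleph0_iff.2 (hc ∅ Set.finite_empty)))
      exact absurd h1 (not_le.2 (by simp))
    obtain ⟨x, hx, hxc⟩ := Set.not_subset.1 h1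
    refine ⟨fun _ => x, fun _ => hx, fun j => ?_⟩
    rwa [show ({j}ᶜ : Set (Fin 1)) = ∅ by ext i; simp [Subsingleton.elim i j], Set.image_empty]
  | succ k ih =>
    obtain ⟨t, hts, ht⟩ := Cardinal.le_mk_iff_exists_subset.1
      ((Cardinal.aleph_le_aleph.2 (show ((k : Ordinal) + 1) ≤ ((k + 1 : ℕ) : Ordinal) + 1 by
        exact_mod_cast Nat.le_succ _)).trans hs)
    have hinf : Infinite t := by
      rw [Cardinal.infinite_iff, ht]
      exact Cardinal.aleph0_le_aleph _
    let D : Set α := ⋃ v : Finset t, c (Subtype.val '' (v : Set t))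
    have hD : #D ≤ ℵ_ (k + 1) := by
      refine (Cardinal.mk_iUnion_le _).trans ?_
      rw [Cardinal.mk_finset_of_infinite, ht]
      refine (mul_le_mul_right (ciSup_le' fun v => Cardinal.mk_le_aleph0_iff.2
        (hc _ (v.finite_toSet.image _))) _).trans ?_
      rw [Cardinal.mul_eq_left (Cardinal.aleph0_le_aleph _) (Cardinal.aleph0_le_aleph _)
        Cardinal.aleph0_ne_zero]
    have h1 : ¬ s ⊆ D := by
      intro hsub
      refine absurd (hs.trans ((Cardinal.mk_le_mk_of_subset hsub).trans hD)) (not_le.2 ?_)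
      rw [Cardinal.aleph_lt_aleph]
      exact_mod_cast Nat.lt_succ_self _
    obtain ⟨x, hx, hxD⟩ := Set.not_subset.1 h1
    obtain ⟨a, hat, hac⟩ := ih (fun v => c (insert x v)) (fun v hv => hc _ (hv.insert x)) t ht.ge
    refine ⟨Fin.cons x a, fun j => ?_, fun j => ?_⟩
    · refine Fin.cases hx (fun i => hts (hat i)) j
    · refine Fin.cases ?_ (fun i => ?_) j
      · rw [Fin.cons_zero]
        intro hmem
        refine hxD (Set.mem_iUnion.2 ⟨Finset.univ.image fun i => ⟨a i, hat i⟩, ?_⟩)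
        convert hmem using 2
        ext y
        simp [Fin.exists_fin_succ (n := k + 1)]
      · rw [Fin.cons_succ]
        convert hac i using 2
        congr 1
        ext y
        simp [Fin.exists_fin_succ, eq_comm]

end Combinatorics

section Presentation

theorem AddSubgroup.free_of_toIntSubmodule {G : Type*} [AddCommGroup G] (H : AddSubgroup G)
    (h : Module.Free ℤ (AddSubgroup.toIntSubmodule H)) : Module.Free ℤ H :=
  h

theorem Gen.x_eq_x_iff {k : ℕ} {m m' : Fin (k + 1)} {η η' : Fin (k + 1) → ℕ → Bool}
    {ν ν' : List Bool} :
    Gen.x m (fun ℓ => η ℓ.1) ν = Gen.x m' (fun ℓ => η' ℓ.1) ν' ↔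
      m = m' ∧ (∀ ℓ, ℓ ≠ m → η ℓ = η' ℓ) ∧ ν = ν' := by
  constructor
  · intro h
    obtain ⟨rfl, h2, rfl⟩ := Gen.x.inj h
    exact ⟨rfl, fun ℓ hℓ => congrFun (eq_of_heq h2) ⟨ℓ, hℓ⟩, rfl⟩
  · rintro ⟨rfl, h, rfl⟩
    congr 1
    funext ℓ
    exact h ℓ.1 ℓ.2

/-- The defining relator of `G_k`, as a finitely supported function on the generators. -/
noncomputable def relator (k : ℕ) (i : (Fin (k + 1) → ℕ → Bool) × ℕ) : Gen k →₀ ℤ :=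
  FreeAbelianGroup.toFinsupp (relGk k i.1 i.2)

theorem relator_eq (k : ℕ) (η : Fin (k + 1) → ℕ → Bool) (n : ℕ) :
    relator k (η, n) = (n.factorial : ℤ) • Finsupp.single (Gen.y η (n + 1)) 1
      - Finsupp.single (Gen.y η n) 1
      - ∑ m : Fin (k + 1),
          Finsupp.single (Gen.x m (fun ℓ => η ℓ.1) ((List.range n).map (η m))) 1 := by
  simp only [relator, relGk, map_sub, map_sum, map_zsmul, FreeAbelianGroup.toFinsupp_of]

/-- The canonical map from the free module on the generators onto `G_k`. -/
noncomputable def toGk (k : ℕ) : (Gen k →₀ ℤ) →ₗ[ℤ] Gk k :=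
  ((QuotientAddGroup.mk' (relSubgroup k)).comp Finsupp.toFreeAbelianGroup).toIntLinearMap

theorem toGk_single (k : ℕ) (g : Gen k) : toGk k (Finsupp.single g 1) = genMk k g := by
  simp [toGk, genMk, Finsupp.toFreeAbelianGroup]

theorem toGk_relator (k : ℕ) (i : (Fin (k + 1) → ℕ → Bool) × ℕ) : toGk k (relator k i) = 0 := by
  simp only [toGk, relator, AddMonoidHom.coe_toIntLinearMap, AddMonoidHom.comp_apply,
    Finsupp.toFreeAbelianGroup_toFinsupp, QuotientAddGroup.mk'_apply,
    QuotientAddGroup.eq_zero_iff]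
  exact AddSubgroup.subset_closure ⟨i.1, i.2, rfl⟩

theorem mem_span_relator_of_toGk_eq_zero (k : ℕ) (v : Gen k →₀ ℤ) (hv : toGk k v = 0) :
    v ∈ Submodule.span ℤ (Set.range (relator k)) := by
  have hmem : Finsupp.toFreeAbelianGroup v ∈ relSubgroup k := by
    rw [← QuotientAddGroup.eq_zero_iff]
    exact hv
  have h : ∀ z ∈ relSubgroup k,
      FreeAbelianGroup.toFinsupp z ∈ Submodule.span ℤ (Set.range (relator k)) := by
    intro z hz
    induction hz using AddSubgroup.closure_induction with
    | mem z hz =>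
      obtain ⟨η, n, rfl⟩ := hz
      exact Submodule.subset_span ⟨(η, n), rfl⟩
    | zero => simp
    | add x y _ _ hx hy => rw [map_add]; exact Submodule.add_mem _ hx hy
    | neg x _ hx => rw [map_neg]; exact Submodule.neg_mem _ hx
  simpa using h _ hmem

open Classical in
/-- The functional on the free module on the generators that reads off the coefficient of a
relator in a combination of relators. -/
noncomputable def relatorCoeff (k : ℕ) (η : Fin (k + 1) → ℕ → Bool) (n : ℕ) :
    (Gen k →₀ ℤ) →ₗ[ℤ] ℤ :=
  Finsupp.linearCombination ℤ fun g : Gen k => match g with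
    | .x _ _ _ => 0
    | .y η' j => if η' = η ∧ j ≤ n then -∏ i ∈ Finset.Ico j n, (i.factorial : ℤ) else 0

open Classical in
theorem relatorCoeff_relator (k : ℕ) (η : Fin (k + 1) → ℕ → Bool) (n : ℕ)
    (i : (Fin (k + 1) → ℕ → Bool) × ℕ) :
    relatorCoeff k η n (relator k i) = if i = (η, n) then 1 else 0 := by
  obtain ⟨η', n'⟩ := i
  rw [relator_eq]
  simp only [relatorCoeff, map_sub, map_sum, map_smul, Finsupp.linearCombination_single,
    smul_eq_mul, one_mul, Finset.sum_const_zero, sub_zero, Prod.mk.injEq]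
  by_cases hη : η' = η
  · rcases lt_trichotomy n' n with h | h | h
    · simp [hη, h.ne, h.le, Nat.succ_le_iff.2 h,
        Finset.prod_eq_prod_Ico_succ_bot h]
    · simp [hη, h]
    · simp [hη, h.ne', not_le.2 h, not_le.2 (h.trans (Nat.lt_succ_self _))]
  · simp [hη]

theorem relatorCoeff_eq_zero (k : ℕ) (U : Set (ℕ → Bool)) (η : Fin (k + 1) → ℕ → Bool)
    (hη : ¬ ∀ j, η j ∈ U) (n : ℕ) (v : Gen k →₀ ℤ)
    (hv : v ∈ Finsupp.supported ℤ ℤ (genIn k U)) : relatorCoeff k η n v = 0 := by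
  rw [relatorCoeff, Finsupp.linearCombination_apply, Finsupp.sum]
  refine Finset.sum_eq_zero fun g hg => ?_
  have hgU := (Finsupp.mem_supported ℤ v).1 hv hg
  rcases g with ⟨m, η', ν⟩ | ⟨η', j⟩
  · simp
  · have : η' ≠ η := by
      rintro rfl
      exact hη hgU
    simp [this]

/-- A combination of generators with indices in `U` that vanishes in `G_k` is a consequence of
the relations with indices in `U`. -/
theorem mem_span_relator_of_supported (k : ℕ) (U : Set (ℕ → Bool)) (v : Gen k →₀ ℤ)
    (hv : v ∈ Finsupp.supported ℤ ℤ (genIn k U)) (h0 : toGk k v = 0) :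
    v ∈ Submodule.span ℤ (Set.range fun i : {η : Fin (k + 1) → ℕ → Bool // ∀ j, η j ∈ U} × ℕ =>
      relator k (i.1.1, i.2)) := by
  classical
  obtain ⟨c, rfl⟩ := Finsupp.mem_span_range_iff_exists_finsupp.1
    (mem_span_relator_of_toGk_eq_zero k v h0)
  refine Submodule.sum_mem _ fun i hi => Submodule.smul_mem _ _ ?_
  by_cases hU : ∀ j, i.1 j ∈ U
  · exact Submodule.subset_span ⟨(⟨i.1, hU⟩, i.2), rfl⟩
  · have h := relatorCoeff_eq_zero k U i.1 hU i.2 _ hv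
    rw [Finsupp.sum, map_sum, Finset.sum_eq_single_of_mem i hi] at h
    · rw [map_smul, relatorCoeff_relator, if_pos rfl, smul_eq_mul, mul_one] at h
      exact absurd h (Finsupp.mem_support_iff.1 hi)
    · intro j _ hj
      rw [map_smul, relatorCoeff_relator, if_neg hj, smul_zero]

theorem GU_eq_map_supported (k : ℕ) (U : Set (ℕ → Bool)) :
    AddSubgroup.toIntSubmodule (GU k U) =
      (Finsupp.supported ℤ ℤ (genIn k U)).map (toGk k) := by
  rw [Finsupp.supported_eq_span_single, Submodule.map_span, ← Set.image_comp]
  have : (toGk k) ∘ (fun g => Finsupp.single g 1) = genMk k := funext (toGk_single k)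
  rw [this, ← Submodule.toAddSubgroup_inj, Submodule.span_int_eq_addSubgroupClosure]
  rfl

theorem GU_mono (k : ℕ) {U V : Set (ℕ → Bool)} (h : U ⊆ V) : GU k U ≤ GU k V := by
  refine AddSubgroup.closure_mono (Set.image_mono ?_)
  rintro (⟨m, η, ν⟩ | ⟨η, j⟩) hg
  · exact fun ℓ => h (hg ℓ)
  · exact fun ℓ => h (hg ℓ)

theorem exists_finite_mem_GU (k : ℕ) (U : Set (ℕ → Bool)) (g : Gk k) (hg : g ∈ GU k U) :
    ∃ w ⊆ U, w.Finite ∧ g ∈ GU k w := by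
  induction hg using AddSubgroup.closure_induction with
  | mem g hg =>
    obtain ⟨(⟨m, η, ν⟩ | ⟨η, j⟩), hg, rfl⟩ := hg
    · exact ⟨Set.range η, Set.range_subset_iff.2 hg, Set.finite_range η,
        AddSubgroup.subset_closure ⟨_, fun ℓ => ⟨ℓ, rfl⟩, rfl⟩⟩
    · exact ⟨Set.range η, Set.range_subset_iff.2 hg, Set.finite_range η,
        AddSubgroup.subset_closure ⟨_, fun ℓ => ⟨ℓ, rfl⟩, rfl⟩⟩
  | zero => exact ⟨∅, Set.empty_subset _, Set.finite_empty, zero_mem _⟩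
  | add x y _ _ hx hy =>
    obtain ⟨w, hw, hwf, hx⟩ := hx
    obtain ⟨w', hw', hwf', hy⟩ := hy
    exact ⟨w ∪ w', Set.union_subset hw hw', hwf.union hwf',
      add_mem (GU_mono k Set.subset_union_left hx) (GU_mono k Set.subset_union_right hy)⟩
  | neg x _ hx =>
    obtain ⟨w, hw, hwf, hx⟩ := hx
    exact ⟨w, hw, hwf, neg_mem hx⟩

theorem GU_univ (k : ℕ) : GU k Set.univ = ⊤ := by
  rw [eq_top_iff]
  rintro g -
  obtain ⟨z, rfl⟩ := QuotientAddGroup.mk_surjective g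
  have hgen : ∀ g : Gen k, genMk k g ∈ GU k Set.univ := by
    rintro (⟨m, η, ν⟩ | ⟨η, j⟩)
    · exact AddSubgroup.subset_closure ⟨.x m η ν, fun _ => trivial, rfl⟩
    · exact AddSubgroup.subset_closure ⟨.y η j, fun _ => trivial, rfl⟩
  induction z using FreeAbelianGroup.induction_on with
  | zero => exact zero_mem _
  | of g => exact hgen g
  | neg g hg => exact neg_mem hg
  | add x y hx hy => exact add_mem hx hy

theorem genIn_countable (k : ℕ) {v : Set (ℕ → Bool)} (hv : v.Countable) :
    (genIn k v).Countable := by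
  have := hv.to_subtype
  let f : ((Σ m : Fin (k + 1), ({ℓ : Fin (k + 1) // ℓ ≠ m} → v) × List Bool) ⊕
      ((Fin (k + 1) → v) × ℕ)) → Gen k :=
    Sum.elim (fun q => .x q.1 (fun ℓ => q.2.1 ℓ) q.2.2) (fun q => .y (fun ℓ => q.1 ℓ) q.2)
  refine (Set.countable_range f).mono ?_
  rintro (⟨m, η, ν⟩ | ⟨η, j⟩) hg
  · exact ⟨.inl ⟨m, fun ℓ => ⟨η ℓ, hg ℓ⟩, ν⟩, rfl⟩
  · exact ⟨.inr (fun ℓ => ⟨η ℓ, hg ℓ⟩, j), rfl⟩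

theorem GU_countable (k : ℕ) {v : Set (ℕ → Bool)} (hv : v.Countable) :
    (GU k v : Set (Gk k)).Countable := by
  have := (genIn_countable k hv).to_subtype
  have h : (GU k v : Set (Gk k)) = (toGk k) '' (Finsupp.supported ℤ ℤ (genIn k v)) :=
    congrArg (fun N : Submodule ℤ (Gk k) => (N : Set (Gk k))) (GU_eq_map_supported k v)
  rw [h]
  refine Set.Countable.image ?_ _
  have : Countable (Finsupp.supported ℤ ℤ (genIn k v)) :=
    (Finsupp.supportedEquivFinsupp (genIn k v)).injective.countable
  exact Set.to_countable _

end Presentation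

section Freeness

open Cardinal

theorem eventually_map_range_ne {β : Type*} {f g : ℕ → β} (h : f ≠ g) :
    ∀ᶠ n in Filter.atTop, (List.range n).map f ≠ (List.range n).map g := by
  obtain ⟨i, hi⟩ := Function.ne_iff.1 h
  filter_upwards [Filter.eventually_gt_atTop i] with n hn heq
  exact hi (List.map_inj_left.1 heq i (List.mem_range.2 hn))

theorem relator_ne_zero {k : ℕ} {η : Fin (k + 1) → ℕ → Bool} {n : ℕ} {g : Gen k}
    (h : relator k (η, n) g ≠ 0) :
    g = .y η (n + 1) ∨ g = .y η n ∨
      ∃ m, g = .x m (fun ℓ => η ℓ.1) ((List.range n).map (η m)) := by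
  by_contra! hne
  obtain ⟨h1, h2, h3⟩ := hne
  refine h ?_
  rw [relator_eq]
  simp [h1.symm, h2.symm, fun m => (h3 m).symm]

theorem relator_apply_y (k : ℕ) (η : Fin (k + 1) → ℕ → Bool) (n : ℕ) :
    relator k (η, n) (.y η n) = -1 := by
  rw [relator_eq]
  simp

theorem relator_apply_x (k : ℕ) (η : Fin (k + 1) → ℕ → Bool) (n : ℕ) (m : Fin (k + 1)) :
    relator k (η, n) (.x m (fun ℓ => η ℓ.1) ((List.range n).map (η m))) = -1 := by
  classical
  rw [relator_eq]
  simp only [Finsupp.sub_apply, Finsupp.smul_apply, Finsupp.finsetSum_apply,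
    Finsupp.single_apply, reduceCtorEq, if_false, smul_zero, zero_sub, sub_zero]
  rw [Finset.sum_eq_single m]
  · simp
  · intro m' _ hm'
    rw [if_neg]
    exact fun h => hm' (Gen.x_eq_x_iff.1 h).1
  · simp

theorem free_quotient_relator (k : ℕ) (U : Set (ℕ → Bool)) (hU : #U ≤ ℵ_ k) :
    Module.Free ℤ ((Gen k →₀ ℤ) ⧸ Submodule.span ℤ
      (Set.range fun i : {η : Fin (k + 1) → ℕ → Bool // ∀ j, η j ∈ U} × ℕ =>
        relator k (i.1.1, i.2))) := by
  classical
  obtain ⟨f, l, hf, hfin⟩ := exists_ordinal_rank_finite_line k U hU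
  have hsep : ∀ a : {η : Fin (k + 1) → ℕ → Bool // ∀ j, η j ∈ U}, ∃ N, ∀ n ≥ N,
      ∀ b ∈ {b | (∀ j, b j ∈ U) ∧ f b < f a.1 ∧ ∀ j, j ≠ l a.1 → b j = a.1 j},
        (List.range n).map (b (l a.1)) ≠ (List.range n).map (a.1 (l a.1)) := by
    intro a
    rw [← Filter.eventually_atTop]
    refine (Filter.eventually_all_finite (hfin a.1 a.2)).2 fun b hb =>
      eventually_map_range_ne fun heq => ?_
    have hba : b = a.1 := by
      funext j
      by_cases hj : j = l a.1
      · rw [hj, heq]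
      · exact hb.2.2 j hj
    exact lt_irrefl _ (hba ▸ hb.2.1)
  choose N hN using hsep
  let d : {η : Fin (k + 1) → ℕ → Bool // ∀ j, η j ∈ U} × ℕ → Gen k := fun i =>
    if i.2 < N i.1 then .y i.1.1 i.2
    else .x (l i.1.1) (fun ℓ => i.1.1 ℓ.1) ((List.range i.2).map (i.1.1 (l i.1.1)))
  refine free_quotient_span_of_triangular _ d ?_
    (fun i => (toLex (f i.1.1, N i.1 - i.2) : Ordinal.{0} ×ₗ ℕ)) ?_
  · rintro ⟨a, n⟩
    by_cases h : n < N a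
    · simpa [d, h] using relator_apply_y k a.1 n
    · simpa [d, h] using relator_apply_x k a.1 n (l a.1)
  · rintro ⟨a, n⟩ ⟨b, n'⟩ hne h
    rw [Prod.Lex.toLex_lt_toLex]
    have hcases := relator_ne_zero h
    by_cases hn' : n' < N b
    · simp only [d, hn', if_true, Gen.y.injEq, reduceCtorEq, exists_false, or_false] at hcases
      rcases hcases with ⟨hab, rfl⟩ | ⟨hab, rfl⟩
      · obtain rfl := Subtype.ext hab
        right
        exact ⟨rfl, by dsimp only; omega⟩
      · exact (hne (Prod.ext (Subtype.ext hab) rfl)).elim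
    · simp only [d, hn', if_false, reduceCtorEq, false_or] at hcases
      obtain ⟨m, hm⟩ := hcases
      obtain ⟨rfl, hoff, hres⟩ := Gen.x_eq_x_iff.1 hm
      obtain rfl : n' = n := by simpa using congrArg List.length hres
      left
      refine lt_of_le_of_ne (not_lt.1 fun hlt => ?_) fun heq => ?_
      · exact hN b n' (not_lt.1 hn') a.1 ⟨a.2, hlt, fun j hj => (hoff j hj).symm⟩ hres.symm
      · exact hne (Prod.ext (Subtype.ext (hf b.2 a.2 heq)) rfl)

theorem free_of_le_GU (k : ℕ) (U : Set (ℕ → Bool)) (hU : #U ≤ ℵ_ k) (H : AddSubgroup (Gk k))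
    (hH : H ≤ GU k U) : Module.Free ℤ H := by
  have := free_quotient_relator k U hU
  set N := Submodule.span ℤ
      (Set.range fun i : {η : Fin (k + 1) → ℕ → Bool // ∀ j, η j ∈ U} × ℕ =>
        relator k (i.1.1, i.2)) with hNdef
  have hN : N ≤ LinearMap.ker (toGk k) := by
    rw [hNdef, Submodule.span_le]
    rintro _ ⟨i, rfl⟩
    exact toGk_relator k _
  refine AddSubgroup.free_of_toIntSubmodule H (Submodule.free_of_injOn (N.liftQ (toGk k) hN)
    ((Finsupp.supported ℤ ℤ (genIn k U)).map N.mkQ) ?_ _ ?_)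
  · rintro _ ⟨v, hv, rfl⟩ h0
    rw [Submodule.mkQ_apply, Submodule.liftQ_apply] at h0
    rw [← LinearMap.mem_ker, Submodule.ker_mkQ]
    exact mem_span_relator_of_supported k U v hv h0
  · rw [← Submodule.map_comp, Submodule.liftQ_mkQ, ← GU_eq_map_supported]
    exact hH

theorem free_of_mk_lt_aleph (k : ℕ) (H : AddSubgroup (Gk k)) (hH : #H < ℵ_ (k + 1)) :
    Module.Free ℤ H := by
  rw [← Cardinal.succ_aleph, Order.lt_succ_iff] at hH
  choose w _ hwf hw using fun h : H => exists_finite_mem_GU k Set.univ h.1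
    (GU_univ k ▸ AddSubgroup.mem_top _)
  refine free_of_le_GU k (⋃ h, w h) ?_ H fun h hh =>
    GU_mono k (Set.subset_iUnion w ⟨h, hh⟩) (hw ⟨h, hh⟩)
  refine (Cardinal.mk_iUnion_le w).trans ?_
  refine (mul_le_mul' hH (ciSup_le' fun h => Cardinal.mk_le_aleph0_iff.2
    (hwf h).countable)).trans ?_
  rw [Cardinal.mul_eq_left (Cardinal.aleph0_le_aleph _) (Cardinal.aleph0_le_aleph _)
    Cardinal.aleph0_ne_zero]

end Freeness

section NonFreeness

open Cardinal

open Classical in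
/-- The homomorphism `G_k → ℚ` that kills every generator except the `y_{η,n}` for the given
`η`, and maps `y_{η,0}` to `1`. -/
noncomputable def toRat (k : ℕ) (η : Fin (k + 1) → ℕ → Bool) : Gk k →+ ℚ :=
  QuotientAddGroup.lift (relSubgroup k)
    (FreeAbelianGroup.lift fun g : Gen k => match g with
      | .x _ _ _ => (0 : ℚ)
      | .y η' n => if η' = η then (∏ i ∈ Finset.range n, (i.factorial : ℚ))⁻¹ else 0) <| by
    rw [relSubgroup, AddSubgroup.closure_le]
    rintro _ ⟨η', n, rfl⟩
    rw [SetLike.mem_coe, AddMonoidHom.mem_ker, relGk]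
    simp only [map_sub, map_sum, map_zsmul, FreeAbelianGroup.lift_apply_of,
      Finset.sum_const_zero, sub_zero]
    by_cases h : η' = η
    · have : (n.factorial : ℚ) ≠ 0 := by positivity
      simp only [h, if_true, Finset.prod_range_succ, mul_inv, zsmul_eq_mul, Int.cast_natCast]
      field_simp
      simp
    · simp [h]

theorem toRat_genMk_y_zero (k : ℕ) (η : Fin (k + 1) → ℕ → Bool) :
    toRat k η (genMk k (.y η 0)) = 1 := by
  simp [toRat, genMk]

theorem toRat_eq_zero_of_mem_GU (k : ℕ) (η : Fin (k + 1) → ℕ → Bool) (m : Fin (k + 1))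
    (w : Set (ℕ → Bool)) (hm : η m ∉ w) (g : Gk k) (hg : g ∈ GU k w) : toRat k η g = 0 := by
  suffices GU k w ≤ (toRat k η).ker from this hg
  rw [GU, AddSubgroup.closure_le]
  rintro _ ⟨(⟨m', η', ν⟩ | ⟨η', n⟩), hg, rfl⟩
  · simp [toRat, genMk]
  · have : η' ≠ η := by
      rintro rfl
      exact hm (hg m)
    simp [toRat, genMk, this]

theorem genMk_y_succ (k : ℕ) (η : Fin (k + 1) → ℕ → Bool) (n : ℕ) :
    (n.factorial : ℤ) • genMk k (.y η (n + 1)) = genMk k (.y η n) +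
      ∑ m : Fin (k + 1), genMk k (.x m (fun ℓ => η ℓ.1) ((List.range n).map (η m))) := by
  have h := toGk_relator k (η, n)
  rw [relator_eq] at h
  simp only [map_sub, map_sum, map_smul, toGk_single] at h
  rwa [sub_sub, sub_eq_zero] at h

theorem Int.eq_zero_of_factorial_mul_succ (z : ℕ → ℤ)
    (h : ∀ n, (n.factorial : ℤ) * z (n + 1) = z n) :
    z 0 = 0 := by
  have hprod : ∀ n, ((∏ i ∈ Finset.range n, i.factorial : ℕ) : ℤ) * z n = z 0 := by
    intro n
    induction n with
    | zero => simp
    | succ n ih =>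
      rw [Finset.prod_range_succ, Nat.cast_mul, mul_assoc, h, ih]
  have hdvd : ∀ n : ℕ, (n.factorial : ℤ) ∣ z 0 := by
    intro n
    rw [← hprod (n + 1), Finset.prod_range_succ, Nat.cast_mul]
    exact Dvd.dvd.mul_right (Dvd.intro_left _ rfl) _
  by_contra hne
  have h1 := Nat.le_of_dvd (Int.natAbs_pos.2 hne)
    (Int.natCast_dvd.1 (hdvd ((z 0).natAbs + 3)))
  have h2 := Nat.lt_factorial_self (n := (z 0).natAbs + 3) (by omega)
  omega

theorem GU_not_free (k : ℕ) (U : Set (ℕ → Bool)) (hU : ℵ_ (k + 1) ≤ #U) :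
    ¬ Module.Free ℤ (GU k U) := by
  classical
  intro hfree
  obtain ⟨⟨ι, b⟩⟩ := Module.Free.exists_basis (R := ℤ) (M := GU k U)
  choose w _ hwf hw using fun i : ι => exists_finite_mem_GU k U (b i) (b i).2
  let c : Set (ℕ → Bool) → Set (ℕ → Bool) := fun v =>
    ⋃ g ∈ genIn k v, ⋃ h : genMk k g ∈ GU k U, ⋃ i ∈ (b.repr ⟨genMk k g, h⟩).support, w i
  have hc : ∀ v, v.Finite → (c v).Countable := fun v hv =>
    (genIn_countable k hv.countable).biUnion fun g _ => Set.countable_iUnion fun h =>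
      (Finset.countable_toSet _).biUnion fun i _ => (hwf i).countable
  obtain ⟨η, hηU, hη⟩ := exists_free_tuple k c hc U hU
  have hyU : ∀ n, genMk k (.y η n) ∈ GU k U := fun n =>
    AddSubgroup.subset_closure ⟨.y η n, hηU, rfl⟩
  have hxU : ∀ (m : Fin (k + 1)) (ν : List Bool), genMk k (.x m (fun ℓ => η ℓ.1) ν) ∈ GU k U :=
    fun m ν => AddSubgroup.subset_closure ⟨.x m (fun ℓ => η ℓ.1) ν, fun ℓ => hηU ℓ.1, rfl⟩
  have hterm : ∀ i, (b.repr ⟨genMk k (.y η 0), hyU 0⟩) i • toRat k η (b i) = 0 := by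
    intro i
    by_cases hm : ∃ m, η m ∉ w i
    · obtain ⟨m, hm⟩ := hm
      rw [toRat_eq_zero_of_mem_GU k η m (w i) hm _ (hw i), smul_zero]
    · push Not at hm
      have hx0 : ∀ m ν, b.repr ⟨genMk k (.x m (fun ℓ => η ℓ.1) ν), hxU m ν⟩ i = 0 := by
        intro m ν
        by_contra hne
        refine hη m ?_
        simp only [c, Set.mem_iUnion]
        exact ⟨.x m (fun ℓ => η ℓ.1) ν, fun ℓ => ⟨ℓ.1, ℓ.2, rfl⟩, hxU m ν, i,
          Finsupp.mem_support_iff.2 hne, hm m⟩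
      have hy0 := Int.eq_zero_of_factorial_mul_succ
        (fun n => b.repr ⟨genMk k (.y η n), hyU n⟩ i) fun n => by
          have hrel : (n.factorial : ℤ) • (⟨genMk k (.y η (n + 1)), hyU (n + 1)⟩ : GU k U) =
              ⟨genMk k (.y η n), hyU n⟩ + ∑ m : Fin (k + 1),
                ⟨genMk k (.x m (fun ℓ => η ℓ.1) ((List.range n).map (η m))), hxU m _⟩ := by
            refine Subtype.ext ?_
            rw [AddSubgroup.coe_add, AddSubgroup.val_finsetSum]
            exact genMk_y_succ k η n
          have := congrArg (fun g => b.repr g i) hrel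
          simpa only [map_smul, map_add, map_sum, Finsupp.smul_apply, Finsupp.add_apply,
            Finsupp.finsetSum_apply, hx0, Finset.sum_const_zero, add_zero, smul_eq_mul] using this
      rw [hy0, zero_smul]
  have hone := toRat_genMk_y_zero k η
  have hsum := b.linearCombination_repr ⟨genMk k (.y η 0), hyU 0⟩
  have hcomp := congrArg ((toRat k η).comp (GU k U).subtype) hsum
  rw [Finsupp.linearCombination_apply, Finsupp.sum, map_sum] at hcomp
  rw [Finset.sum_eq_zero fun i _ => ?_] at hcomp
  · exact zero_ne_one (hcomp.trans hone)
  · rw [map_zsmul]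
    exact hterm i

theorem mk_GU_le (k : ℕ) (U : Set (ℕ → Bool)) (hU : Infinite U) : #(GU k U) ≤ #U := by
  have hsub : (GU k U : Set (Gk k)) ⊆
      ⋃ v : Finset U, (GU k (Subtype.val '' (v : Set U)) : Set (Gk k)) := by
    intro g hg
    obtain ⟨w, hwU, hwf, hgw⟩ := exists_finite_mem_GU k U g hg
    lift w to Set U using hwU
    exact Set.mem_iUnion.2 ⟨(hwf.of_finite_image Subtype.val_injective.injOn).toFinset,
      by simpa using hgw⟩
  refine (Cardinal.mk_le_mk_of_subset hsub).trans ((Cardinal.mk_iUnion_le _).trans ?_)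
  rw [Cardinal.mk_finset_of_infinite]
  refine (mul_le_mul_right (ciSup_le' fun v => Cardinal.mk_le_aleph0_iff.2
    (GU_countable k (v.finite_toSet.image _).countable)) _).trans ?_
  rw [Cardinal.mul_eq_left (Cardinal.infinite_iff.1 hU) (Cardinal.infinite_iff.1 hU)
    Cardinal.aleph0_ne_zero]

end NonFreeness

theorem aleph_le_two_power_aleph0_of_universe.{u} (k : ℕ)
    (h : (Cardinal.aleph (k + 1) : Cardinal.{u}) ≤ 2 ^ Cardinal.aleph0) :
    (Cardinal.aleph (k + 1) : Cardinal.{0}) ≤ 2 ^ Cardinal.aleph0 := by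
  rw [← Cardinal.lift_le.{u}]
  simpa using h

/-- `G_k` is `ℵ_{k+1}`-free: every subgroup of cardinality less than `ℵ_{k+1}` is a free
abelian group; and if `2^{ℵ₀} ≥ ℵ_{k+1}`, then `G_k` is not free, and moreover `G_k` is
not `ℵ_{k+2}`-free: it has a non-free subgroup of cardinality `ℵ_{k+1}`. -/
theorem Gk_almost_free_not_free (k : ℕ) :
    (∀ H : AddSubgroup (Gk k), Cardinal.mk H < Cardinal.aleph (k + 1) →
      Module.Free ℤ H) ∧
    (Cardinal.aleph (k + 1) ≤ 2 ^ Cardinal.aleph0 →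
      ¬ Module.Free ℤ (Gk k) ∧
      ∃ H : AddSubgroup (Gk k), Cardinal.mk H = Cardinal.aleph (k + 1) ∧
        ¬ Module.Free ℤ H) := by
  refine ⟨free_of_mk_lt_aleph k, fun hcont => ?_⟩
  have hreal : Cardinal.aleph (k + 1) ≤ Cardinal.mk (Set.univ : Set (ℕ → Bool)) := by
    simpa using aleph_le_two_power_aleph0_of_universe k hcont
  obtain ⟨U, -, hU⟩ := Cardinal.le_mk_iff_exists_subset.1 hreal
  have hnot := GU_not_free k U hU.ge
  refine ⟨fun hfree => hnot ?_, GU k U, le_antisymm ?_ ?_, hnot⟩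
  · exact AddSubgroup.free_of_toIntSubmodule _ (Submodule.free_of_isPrincipalIdealRing _)
  · rw [← hU]
    refine mk_GU_le k U ?_
    rw [Cardinal.infinite_iff, hU]
    exact Cardinal.aleph0_le_aleph _
  · by_contra hlt
    exact hnot (free_of_mk_lt_aleph k _ (not_le.1 hlt))
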